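/- Let b = ρΦ ∈ C¹_♯(Y_d)^d, where ρ ∈ C¹_♯(Y_d) is nonnegative, not identically zero, and vanishes at some point, and Φ ∈ C¹_♯(Y_d)^d vanishes nowhere; let (ρ_n) ⊂ C¹_♯(Y_d) be positive with ρ ≤ ρ_n, ρ_n → ρ uniformly, and with rotation set of ρ_nΦ a singleton {ζ_n} for each n, and let ζ := lim_n ζ_n (which exists). For x ∈ ℝ^d, let F_x denote the closure in Y_d of the projection onto Y_d of the orbit X(ℝ,x). If F_x ∩ {ρ = 0} = ∅, then lim_{t→∞} X(t,x)/t = ζ. -/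

import Mathlib

open MeasureTheory Filter Matrix

noncomputable section

/-- A function on `ℝ^d` is `ℤ^d`-periodic. -/
def ZdPeriodic {d : ℕ} {E : Type*} (f : (Fin d → ℝ) → E) : Prop :=
  ∀ (κ : Fin d → ℤ) (x : Fin d → ℝ), f (x + fun i => (κ i : ℝ)) = f x

/-- The unit cube `[0,1)^d`, a fundamental domain for the torus `Y_d = ℝ^d/ℤ^d`. -/
def unitCube (d : ℕ) : Set (Fin d → ℝ) := {x | ∀ i, x i ∈ Set.Ico (0 : ℝ) 1}

/-- `X` is the global flow of the vector field `b`: `∂X/∂t(t,x) = b(X(t,x))`, `X(0,x) = x`. -/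
def IsFlowOf {d : ℕ} (b : (Fin d → ℝ) → (Fin d → ℝ))
    (X : ℝ → (Fin d → ℝ) → (Fin d → ℝ)) : Prop :=
  ∀ x : Fin d → ℝ, X 0 x = x ∧ ∀ t : ℝ, HasDerivAt (fun s => X s x) (b (X t x)) t

/-- A measure `μ` on the torus `Y_d` (identified with a measure on `ℝ^d` carried by the unit
cube) is invariant for the flow `X`: `∫ ψ(X(t,y)) dμ = ∫ ψ dμ` for all `t` and all continuous
`ℤ^d`-periodic `ψ`. -/
def FlowInvariant {d : ℕ} (X : ℝ → (Fin d → ℝ) → (Fin d → ℝ))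
    (μ : Measure (Fin d → ℝ)) : Prop :=
  ∀ (t : ℝ) (ψ : (Fin d → ℝ) → ℝ), Continuous ψ → ZdPeriodic ψ →
    ∫ y, ψ (X t y) ∂μ = ∫ y, ψ y ∂μ

/-- Herman's rotation set `C_b = {∫ b dμ : μ invariant probability measure for the flow}`. -/
def rotationSet {d : ℕ} (b : (Fin d → ℝ) → (Fin d → ℝ))
    (X : ℝ → (Fin d → ℝ) → (Fin d → ℝ)) : Set (Fin d → ℝ) :=
  {ζ | ∃ μ : Measure (Fin d → ℝ), IsProbabilityMeasure μ ∧ μ (unitCube d)ᶜ = 0 ∧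
        FlowInvariant X μ ∧ ζ = ∫ y, b y ∂μ}

/-- The gradient of a scalar function on `ℝ^d`. -/
def grad {d : ℕ} (ψ : (Fin d → ℝ) → ℝ) (y : Fin d → ℝ) : Fin d → ℝ :=
  fun i => fderiv ℝ ψ y (Pi.single i 1)


open scoped NNReal

section Periodic

variable {d : ℕ} {E : Type*}

/-- Coordinatewise fractional part, the projection of `ℝ^d` onto the unit cube. -/
def fractVec (x : Fin d → ℝ) : Fin d → ℝ := fun i => Int.fract (x i)

lemma fractVec_mem_unitCube (x : Fin d → ℝ) : fractVec x ∈ unitCube d :=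
  fun _ => ⟨Int.fract_nonneg _, Int.fract_lt_one _⟩

lemma unitCube_subset_Icc : unitCube d ⊆ Set.Icc 0 1 :=
  fun _ hx => ⟨fun i => (hx i).1, fun i => (hx i).2.le⟩

lemma measurableSet_unitCube : MeasurableSet (unitCube d) := by
  have : unitCube d = Set.pi Set.univ fun _ => Set.Ico (0 : ℝ) 1 := by
    ext; simp [unitCube]
  rw [this]
  exact MeasurableSet.univ_pi fun _ => measurableSet_Ico

lemma measurable_fractVec : Measurable (fractVec (d := d)) :=
  measurable_pi_lambda _ fun i => measurable_fract.comp (measurable_pi_apply i)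

lemma ZdPeriodic.apply_fractVec {f : (Fin d → ℝ) → E} (hf : ZdPeriodic f) (x : Fin d → ℝ) :
    f (fractVec x) = f x := by
  rw [← hf (fun i => ⌊x i⌋) (fractVec x)]
  congr 1
  ext i
  exact Int.fract_add_floor (x i)

lemma ZdPeriodic.exists_norm_le [SeminormedAddCommGroup E] {f : (Fin d → ℝ) → E}
    (hf : ZdPeriodic f) (hc : Continuous f) : ∃ C, ∀ x, ‖f x‖ ≤ C := by
  obtain ⟨C, hC⟩ := (isCompact_Icc (a := (0 : Fin d → ℝ)) (b := 1)).exists_bound_of_continuousOn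
    hc.continuousOn
  refine ⟨C, fun x => ?_⟩
  rw [← hf.apply_fractVec x]
  exact hC _ (unitCube_subset_Icc (fractVec_mem_unitCube x))

lemma ZdPeriodic.exists_lipschitzWith [NormedAddCommGroup E] [NormedSpace ℝ E]
    {f : (Fin d → ℝ) → E} (hf : ZdPeriodic f) (hc : ContDiff ℝ 1 f) :
    ∃ K : ℝ≥0, LipschitzWith K f := by
  have hper : ZdPeriodic (fderiv ℝ f) := fun κ x => by
    rw [← fderiv_comp_add_right]
    congr 1
    exact funext fun y => hf κ y
  obtain ⟨C, hC⟩ := hper.exists_norm_le (hc.continuous_fderiv one_ne_zero)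
  refine ⟨C.toNNReal, lipschitzWith_of_nnnorm_fderiv_le (hc.differentiable one_ne_zero)
    fun x => ?_⟩
  exact_mod_cast (hC x).trans (Real.le_coe_toNNReal C)

end Periodic

section Flow

variable {d : ℕ} {b : (Fin d → ℝ) → (Fin d → ℝ)} {X : ℝ → (Fin d → ℝ) → (Fin d → ℝ)}

lemma IsFlowOf.continuous_orbit (hX : IsFlowOf b X) (x : Fin d → ℝ) :
    Continuous fun t => X t x :=
  continuous_iff_continuousAt.2 fun t => ((hX x).2 t).continuousAt

lemma IsFlowOf.eq_of_hasDerivAt (hX : IsFlowOf b X) {K : ℝ≥0} (hb : LipschitzWith K b)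
    {γ : ℝ → Fin d → ℝ} (hγ : ∀ t, HasDerivAt γ (b (γ t)) t) (t : ℝ) :
    γ t = X t (γ 0) := by
  refine congrFun (ODE_solution_unique_univ (v := fun _ => b) (s := fun _ => Set.univ) (t₀ := 0)
    (K := K) (f := γ) (g := fun t => X t (γ 0))
    (fun _ => hb.lipschitzOnWith) (fun t => ⟨hγ t, trivial⟩) (fun t => ⟨(hX _).2 t, trivial⟩) (hX _).1.symm) t

lemma IsFlowOf.apply_apply (hX : IsFlowOf b X) {K : ℝ≥0} (hb : LipschitzWith K b)
    (t s : ℝ) (x : Fin d → ℝ) : X t (X s x) = X (t + s) x := by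
  have := hX.eq_of_hasDerivAt hb (γ := fun t => X (t + s) x)
    (fun t => ((hX x).2 (t + s)).comp_add_const t s) t
  simpa using this.symm

lemma IsFlowOf.add_int (hX : IsFlowOf b X) {K : ℝ≥0} (hb : LipschitzWith K b)
    (hper : ZdPeriodic b) (t : ℝ) (κ : Fin d → ℤ) (x : Fin d → ℝ) :
    X t (x + fun i => (κ i : ℝ)) = X t x + fun i => (κ i : ℝ) := by
  have := hX.eq_of_hasDerivAt hb (γ := fun t => X t x + fun i => (κ i : ℝ))
    (fun t => by simpa only [hper κ] using ((hX x).2 t).add_const _) t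
  simpa [(hX x).1] using this.symm

lemma IsFlowOf.neg (hX : IsFlowOf b X) : IsFlowOf (fun y => -b y) (fun t => X (-t)) := by
  refine fun x => ⟨by simpa using (hX x).1, fun t => ?_⟩
  have := ((hX x).2 (-t)).scomp t (hasDerivAt_neg t)
  rw [neg_one_smul] at this
  exact this

lemma IsFlowOf.continuous_of_nonneg (hX : IsFlowOf b X) {K : ℝ≥0} (hb : LipschitzWith K b)
    {t : ℝ} (ht : 0 ≤ t) : Continuous (X t) := by
  refine (LipschitzWith.of_dist_le_mul (K := (Real.exp (K * t)).toNNReal) fun x y => ?_).continuous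
  have := dist_le_of_trajectories_ODE (v := fun _ => b) (K := K) (f := fun t => X t x)
    (g := fun t => X t y) (a := 0) (b := t) (δ := dist x y) (fun _ => hb)
    (hX.continuous_orbit x).continuousOn (fun s _ => ((hX x).2 s).hasDerivWithinAt)
    (hX.continuous_orbit y).continuousOn (fun s _ => ((hX y).2 s).hasDerivWithinAt)
    (by rw [(hX x).1, (hX y).1]) t ⟨ht, le_rfl⟩
  rw [Real.coe_toNNReal _ (Real.exp_pos _).le, mul_comm]
  simpa using this

lemma IsFlowOf.continuous (hX : IsFlowOf b X) {K : ℝ≥0} (hb : LipschitzWith K b)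
    (t : ℝ) : Continuous (X t) := by
  rcases le_total 0 t with ht | ht
  · exact hX.continuous_of_nonneg hb ht
  · simpa using hX.neg.continuous_of_nonneg hb.neg (neg_nonneg.2 ht)

/-- Two orbits of proportional vector fields with the same starting point agree after the
corresponding time change. -/
lemma IsFlowOf.eq_time_change (hX : IsFlowOf b X) {K : ℝ≥0} (hb : LipschitzWith K b)
    {a τ : ℝ → ℝ} (ha : ∀ t, |a t| ≤ 1) (hτ : ∀ t, HasDerivAt τ (a t) t) (hτ0 : τ 0 = 0)
    {γ : ℝ → Fin d → ℝ} (hγ : ∀ t, HasDerivAt γ (a t • b (γ t)) t) (t : ℝ) :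
    γ t = X (τ t) (γ 0) := by
  refine congrFun (ODE_solution_unique_univ (v := fun t y => a t • b y)
    (s := fun _ => Set.univ) (t₀ := 0) (K := K) (f := γ) (g := fun t => X (τ t) (γ 0))
    (fun t => LipschitzWith.lipschitzOnWith ?_) (fun t => ⟨hγ t, trivial⟩)
    (fun t => ⟨?_, trivial⟩) ?_) t
  · refine LipschitzWith.of_dist_le_mul fun x y => ?_
    rw [dist_smul₀, Real.norm_eq_abs]
    exact (mul_le_of_le_one_left dist_nonneg (ha t)).trans (hb.dist_le_mul x y)
  · exact ((hX (γ 0)).2 (τ t)).scomp t (hτ t)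
  · rw [hτ0, (hX _).1]

end Flow

section Empirical

variable {d : ℕ}

/-- Along any ultrafilter, the time averages of a continuous curve on the torus converge to the
averages against some probability measure. -/
lemma exists_measure_tendsto_average {γ : ℝ → Fin d → ℝ} (hγ : Continuous γ) (U : Ultrafilter ℝ) :
    ∃ μ : Measure (Fin d → ℝ), IsProbabilityMeasure μ ∧ μ (unitCube d)ᶜ = 0 ∧
      ∀ ψ : (Fin d → ℝ) → ℝ, Continuous ψ → ZdPeriodic ψ →
        Tendsto (fun T => ∫ s in (0 : ℝ)..1, ψ (γ (T * s))) U (nhds (∫ y, ψ y ∂μ)) := by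
  let Q := Set.Icc (0 : Fin d → ℝ) 1
  have : CompactSpace Q := isCompact_iff_compactSpace.1 isCompact_Icc
  let lam : Measure ℝ := volume.restrict (Set.Ioc 0 1)
  have : IsProbabilityMeasure lam := ⟨by simp [lam]⟩
  let e : ℝ → ℝ → Q := fun T s =>
    ⟨fractVec (γ (T * s)), unitCube_subset_Icc (fractVec_mem_unitCube _)⟩
  have he : ∀ T, Measurable (e T) := fun T =>
    (measurable_fractVec.comp (hγ.comp (continuous_const.mul continuous_id)).measurable).subtype_mk
  let ν : ℝ → ProbabilityMeasure Q := fun T =>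
    ⟨lam.map (e T), Measure.isProbabilityMeasure_map (he T).aemeasurable⟩
  obtain ⟨m, -, hm⟩ := isCompact_univ.ultrafilter_le_nhds (U.map ν) (by simp)
  have hm' : Tendsto ν U (nhds m) := hm
  have hF : Measurable fun q : Q => fractVec (q : Fin d → ℝ) :=
    measurable_fractVec.comp measurable_subtype_coe
  refine ⟨(m : Measure Q).map fun q : Q => fractVec (q : Fin d → ℝ),
    Measure.isProbabilityMeasure_map hF.aemeasurable, ?_, fun ψ hψ hper => ?_⟩
  · rw [Measure.map_apply hF measurableSet_unitCube.compl]
    convert measure_empty (μ := (m : Measure Q))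
    ext q
    simp [fractVec_mem_unitCube]
  · let g : BoundedContinuousFunction Q ℝ :=
      BoundedContinuousFunction.mkOfCompact ⟨fun q => ψ q, hψ.comp continuous_subtype_val⟩
    have key := ProbabilityMeasure.tendsto_iff_forall_integral_tendsto.1 hm' g
    rw [integral_map hF.aemeasurable hψ.aestronglyMeasurable]
    simp only [hper.apply_fractVec]
    refine key.congr fun T => ?_
    change ∫ q, g q ∂(lam.map (e T)) = _
    rw [integral_map (he T).aemeasurable g.continuous.aestronglyMeasurable,
      intervalIntegral.integral_of_le zero_le_one]
    exact integral_congr_ae (ae_of_all _ fun s => hper.apply_fractVec _)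

/-- Shifting a bounded continuous function does not change its asymptotic time averages. -/
lemma tendsto_average_shift_sub {f : ℝ → ℝ} (hf : Continuous f) {C : ℝ} (hC : ∀ s, |f s| ≤ C)
    (t : ℝ) :
    Tendsto (fun T => (∫ s in (0 : ℝ)..1, f (t + T * s)) - ∫ s in (0 : ℝ)..1, f (T * s))
      atTop (nhds 0) := by
  have hlim : Tendsto (fun T : ℝ => (2 * (C * |t|)) * T⁻¹) atTop (nhds 0) := by
    simpa using tendsto_inv_atTop_zero.const_mul (2 * (C * |t|))
  refine squeeze_zero_norm' ?_ hlim
  filter_upwards [eventually_gt_atTop 0] with T hT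
  have hi : ∀ a c, IntervalIntegrable f volume a c := fun a c => hf.intervalIntegrable a c
  rw [intervalIntegral.integral_comp_mul_left (fun s => f (t + s)) hT.ne',
    intervalIntegral.integral_comp_mul_left f hT.ne', intervalIntegral.integral_comp_add_left,
    ← smul_sub, mul_zero, mul_one, add_zero,
    intervalIntegral.integral_interval_sub_interval_comm (hi _ _) (hi _ _) (hi _ _),
    norm_smul, norm_inv, Real.norm_of_nonneg hT.le, mul_comm]
  gcongr
  have h1 : ‖∫ s in t..0, f s‖ ≤ C * |t| := by
    simpa using intervalIntegral.norm_integral_le_of_norm_le_const (a := t) (b := 0)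
      (f := f) (C := C) (fun s _ => hC s)
  have h2 : ‖∫ s in (t + T)..T, f s‖ ≤ C * |t| := by
    simpa using intervalIntegral.norm_integral_le_of_norm_le_const (a := t + T) (b := T)
      (f := f) (C := C) (fun s _ => hC s)
  linarith [norm_sub_le (∫ s in t..0, f s) (∫ s in (t + T)..T, f s)]

/-- If the rotation set of a Lipschitz periodic field is a singleton, every orbit has that
asymptotic velocity. -/
lemma IsFlowOf.tendsto_of_rotationSet_eq_singleton {b : (Fin d → ℝ) → (Fin d → ℝ)}
    {X : ℝ → (Fin d → ℝ) → (Fin d → ℝ)} (hX : IsFlowOf b X) {K : ℝ≥0} (hb : LipschitzWith K b)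
    (hper : ZdPeriodic b) {ζ : Fin d → ℝ} (hζ : rotationSet b X = {ζ}) (x : Fin d → ℝ) :
    Tendsto (fun t : ℝ => t⁻¹ • X t x) atTop (nhds ζ) := by
  rw [tendsto_iff_ultrafilter]
  intro U hU
  obtain ⟨μ, hμ, hcube, hlim⟩ := exists_measure_tendsto_average (hX.continuous_orbit x) U
  have hinv : FlowInvariant X μ := by
    intro t ψ hψ hψper
    have hψX : ZdPeriodic fun y => ψ (X t y) := fun κ y => by
      simp only [hX.add_int hb hper, hψper κ]
    have h1 := hlim _ (hψ.comp (hX.continuous hb t)) hψX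
    have h2 := hlim ψ hψ hψper
    obtain ⟨C, hC⟩ := hψper.exists_norm_le hψ
    have h3 := (tendsto_average_shift_sub (hψ.comp (hX.continuous_orbit x))
      (fun s => hC _) t).mono_left hU
    simp only [Function.comp_apply, hX.apply_apply hb] at h1 h3
    exact sub_eq_zero.1 (tendsto_nhds_unique (h1.sub h2) h3)
  have hmem : (∫ y, b y ∂μ) ∈ rotationSet b X := ⟨μ, hμ, hcube, hinv, rfl⟩
  rw [hζ, Set.mem_singleton_iff] at hmem
  obtain ⟨C, hC⟩ := hper.exists_norm_le hb.continuous
  have hcomp : ∀ i, Continuous fun y => b y i := fun i => (continuous_apply i).comp hb.continuous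
  have hint : ∀ i, Integrable (fun y => b y i) μ := fun i =>
    Integrable.of_bound (hcomp i).aestronglyMeasurable C
      (ae_of_all _ fun y => (norm_le_pi_norm (b y) i).trans (hC y))
  rw [tendsto_pi_nhds]
  intro i
  have hbi := hlim (fun y => b y i) (hcomp i) fun κ y => by simp only [hper κ]
  rw [← hmem, eval_integral hint]
  have hx : Tendsto (fun T : ℝ => T⁻¹ * x i) U (nhds 0) := by
    simpa using (tendsto_inv_atTop_zero.mul_const (x i)).mono_left hU
  have hsum := hx.add hbi
  rw [zero_add] at hsum
  refine hsum.congr' (hU ?_)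
  filter_upwards [eventually_gt_atTop 0] with T hT
  have hftc : ∫ s in (0 : ℝ)..T, b (X s x) i = X T x i - X 0 x i :=
    intervalIntegral.integral_eq_sub_of_hasDerivAt
      (fun s _ => hasDerivAt_pi.1 ((hX x).2 s) i)
      (((hcomp i).comp (hX.continuous_orbit x)).intervalIntegrable _ _)
  rw [intervalIntegral.integral_comp_mul_left (fun s => b (X s x) i) hT.ne', mul_zero, mul_one,
    hftc, (hX x).1]
  simp [mul_sub]

end Empirical

section TimeChange

variable {d : ℕ}

/-- If `σ ≤ ρ` are nearly proportional along an orbit of `σ Φ`, then the asymptotic velocity of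
this orbit is close to that of the orbit of `ρ Φ`. -/
lemma IsFlowOf.eventually_norm_sub_le {σ ρ : (Fin d → ℝ) → ℝ} {Φ : (Fin d → ℝ) → (Fin d → ℝ)}
    {X Y : ℝ → (Fin d → ℝ) → (Fin d → ℝ)} (hX : IsFlowOf (fun y => σ y • Φ y) X)
    (hY : IsFlowOf (fun y => ρ y • Φ y) Y) {K : ℝ≥0} (hK : LipschitzWith K fun y => ρ y • Φ y)
    (hσ : Continuous σ) (hρ : Continuous ρ) (hpos : ∀ y, 0 < ρ y) (hle : ∀ y, σ y ≤ ρ y)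
    {x : Fin d → ℝ} {η : ℝ} (hη : η < 1) (hnear : ∀ t, (1 - η) * ρ (X t x) ≤ σ (X t x))
    {ζ : Fin d → ℝ} (hζ : Tendsto (fun t : ℝ => t⁻¹ • Y t x) atTop (nhds ζ))
    {δ : ℝ} (hδ : 0 < δ) :
    ∀ᶠ t in atTop, ‖t⁻¹ • X t x - ζ‖ ≤ δ + η * ‖ζ‖ := by
  set a : ℝ → ℝ := fun t => σ (X t x) / ρ (X t x)
  have ha_cont : Continuous a :=
    (hσ.comp (hX.continuous_orbit x)).div (hρ.comp (hX.continuous_orbit x)) fun t => (hpos _).ne'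
  have ha_le : ∀ t, a t ≤ 1 := fun t => (div_le_one (hpos _)).2 (hle _)
  have ha_ge : ∀ t, 1 - η ≤ a t := fun t => (le_div_iff₀ (hpos _)).2 (hnear t)
  have ha_abs : ∀ t, |a t| ≤ 1 := fun t => abs_le.2 ⟨by linarith [ha_ge t], ha_le t⟩
  set τ : ℝ → ℝ := fun t => ∫ s in (0 : ℝ)..t, a s with hτ_def
  have hτ : ∀ t, HasDerivAt τ (a t) t := fun t =>
    intervalIntegral.integral_hasDerivAt_right (ha_cont.intervalIntegrable _ _)
      ha_cont.stronglyMeasurable.stronglyMeasurableAtFilter ha_cont.continuousAt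
  have hXY : ∀ t, X t x = Y (τ t) x := fun t => by
    have := hY.eq_time_change hK ha_abs hτ (by simp [hτ_def]) (γ := fun t => X t x)
      (fun t => by
        have : HasDerivAt (fun s => X s x) (σ (X t x) • Φ (X t x)) t := (hX x).2 t
        rwa [← div_mul_cancel₀ (σ (X t x)) (hpos (X t x)).ne', mul_smul] at this) t
    rwa [(hX x).1] at this
  have hτ_le : ∀ t, 0 ≤ t → τ t ≤ t := fun t ht => by
    simpa using intervalIntegral.integral_mono_on (μ := volume) ht (ha_cont.intervalIntegrable 0 t)
      (intervalIntegrable_const (c := (1 : ℝ))) fun s _ => ha_le s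
  have hτ_ge : ∀ t, 0 ≤ t → (1 - η) * t ≤ τ t := fun t ht => by
    have := intervalIntegral.integral_mono_on (μ := volume) ht
      (intervalIntegrable_const (c := 1 - η)) (ha_cont.intervalIntegrable 0 t) fun s _ => ha_ge s
    rwa [intervalIntegral.integral_const, sub_zero, smul_eq_mul, mul_comm] at this
  have hτ_top : Tendsto τ atTop atTop := by
    refine tendsto_atTop_mono' _ ?_ (tendsto_id.const_mul_atTop (sub_pos.2 hη))
    filter_upwards [eventually_ge_atTop 0] with t ht using hτ_ge t ht
  have hlim := (tendsto_iff_norm_sub_tendsto_zero.1 (hζ.comp hτ_top)).eventually_le_const hδ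
  filter_upwards [hlim, eventually_gt_atTop 0] with t ht ht0
  have hτ0 : 0 < τ t := (mul_pos (sub_pos.2 hη) ht0).trans_le (hτ_ge t ht0.le)
  have hr1 : t⁻¹ * τ t ≤ 1 := by
    rw [inv_mul_le_iff₀ ht0, mul_one]; exact hτ_le t ht0.le
  have hr0 : 0 ≤ t⁻¹ * τ t := by positivity
  have hrη : 1 - η ≤ t⁻¹ * τ t := by
    rw [le_inv_mul_iff₀ ht0, mul_comm]; exact hτ_ge t ht0.le
  have hdecomp : t⁻¹ • X t x - ζ
      = (t⁻¹ * τ t) • ((τ t)⁻¹ • Y (τ t) x - ζ) + (t⁻¹ * τ t - 1) • ζ := by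
    rw [hXY t, smul_sub, smul_smul, mul_assoc, mul_inv_cancel₀ hτ0.ne', mul_one, sub_smul,
      one_smul]
    abel
  rw [hdecomp]
  refine (norm_add_le _ _).trans (add_le_add ?_ ?_)
  · rw [norm_smul, Real.norm_of_nonneg hr0]
    exact (mul_le_of_le_one_left (norm_nonneg _) hr1).trans ht
  · rw [norm_smul]
    gcongr
    rw [Real.norm_eq_abs, abs_sub_comm, abs_of_nonneg (sub_nonneg.2 hr1)]
    linarith

end TimeChange

/-- In the setting of the perturbation theorem (with `ρ` vanishing somewhere
and `ζ := lim ζ_n`), if the closure `F_x` in `Y_d` of the projection of the orbit `X(ℝ,x)`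
does not meet `{ρ = 0}`, then `X(t,x)/t → ζ` as `t → ∞`. -/
theorem flow_asymptotics_orbit_away_from_zero_set {d : ℕ} (hd : 1 ≤ d)
    (ρ : (Fin d → ℝ) → ℝ) (hρ : ContDiff ℝ 1 ρ) (hρper : ZdPeriodic ρ)
    (hρ0 : ∀ y, 0 ≤ ρ y) (hρne : ∃ y, ρ y ≠ 0)
    (Φ : (Fin d → ℝ) → (Fin d → ℝ)) (hΦ : ContDiff ℝ 1 Φ) (hΦper : ZdPeriodic Φ)
    (hΦne : ∀ y, Φ y ≠ 0)
    (X : ℝ → (Fin d → ℝ) → (Fin d → ℝ)) (hX : IsFlowOf (fun y => ρ y • Φ y) X)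
    (ρn : ℕ → (Fin d → ℝ) → ℝ)
    (hρn : ∀ n, ContDiff ℝ 1 (ρn n)) (hρnper : ∀ n, ZdPeriodic (ρn n))
    (hρnpos : ∀ n y, 0 < ρn n y) (hle : ∀ n y, ρ y ≤ ρn n y)
    (hunif : TendstoUniformly ρn ρ atTop)
    (Xn : ℕ → ℝ → (Fin d → ℝ) → (Fin d → ℝ))
    (hXn : ∀ n, IsFlowOf (fun y => ρn n y • Φ y) (Xn n))
    (ζn : ℕ → Fin d → ℝ)
    (hsin : ∀ n, rotationSet (fun y => ρn n y • Φ y) (Xn n) = {ζn n})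
    (hvan : ∃ x₀, ρ x₀ = 0)
    (ζ : Fin d → ℝ) (hζ : Tendsto ζn atTop (nhds ζ))
    (x : Fin d → ℝ)
    (hFx : closure (Set.range fun t : ℝ => fun i => Int.fract (X t x i)) ∩
        {y | ρ y = 0} = ∅) :
    Tendsto (fun t : ℝ => t⁻¹ • X t x) atTop (nhds ζ) := by

  obtain ⟨c, hc, hcX⟩ : ∃ c, 0 < c ∧ ∀ t, c ≤ ρ (X t x) := by
    set F := closure (Set.range fun t : ℝ => fractVec (X t x))
    have hsub : F ⊆ Set.Icc 0 1 := closure_minimal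
      (Set.range_subset_iff.2 fun t => unitCube_subset_Icc (fractVec_mem_unitCube _)) isClosed_Icc
    obtain ⟨y, hy, hmin⟩ := (isCompact_Icc.of_isClosed_subset isClosed_closure hsub).exists_isMinOn
      ((Set.range_nonempty _).closure) hρ.continuous.continuousOn
    refine ⟨ρ y, (hρ0 y).lt_of_ne fun h => ?_, fun t => ?_⟩
    · exact Set.eq_empty_iff_forall_notMem.1 hFx y ⟨hy, h.symm⟩
    · rw [← hρper.apply_fractVec (X t x)]
      exact hmin (subset_closure ⟨t, rfl⟩)
  rw [Metric.tendsto_nhds]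
  intro δ hδ
  set M : ℝ := ‖ζ‖ + 1
  have hMpos : 0 < M := by positivity
  set η : ℝ := min (1 / 2) (δ / (4 * M))
  have hη0 : 0 < η := by positivity
  obtain ⟨n, hnρ, hnζ⟩ := ((Metric.tendstoUniformly_iff.1 hunif (η * c) (by positivity)).and
    (Metric.tendsto_nhds.1 hζ (min (δ / 4) 1) (by positivity))).exists
  rw [dist_eq_norm] at hnζ
  have hnM : ‖ζn n‖ ≤ M := by
    have := norm_le_norm_add_norm_sub' (ζn n) ζ
    linarith [min_le_right (δ / 4) 1]
  have hper : ZdPeriodic fun y => ρn n y • Φ y := fun κ y => by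
    simp only [hρnper n κ y, hΦper κ y]
  obtain ⟨K, hK⟩ := hper.exists_lipschitzWith ((hρn n).smul hΦ)
  have hnear : ∀ t, (1 - η) * ρn n (X t x) ≤ ρ (X t x) := fun t => by
    have h1 := hnρ (X t x)
    rw [Real.dist_eq, abs_sub_comm] at h1
    have h2 := (le_abs_self _).trans_lt h1
    have h3 : η * c ≤ η * ρn n (X t x) :=
      mul_le_mul_of_nonneg_left ((hcX t).trans (hle n _)) hη0.le
    linarith
  have hev := hX.eventually_norm_sub_le (hXn n) hK hρ.continuous (hρn n).continuous (hρnpos n)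
    (hle n) (by linarith [min_le_left (1 / 2) (δ / (4 * M))]) hnear
    ((hXn n).tendsto_of_rotationSet_eq_singleton hK hper (hsin n) x)
    (show 0 < δ / 4 by positivity)
  filter_upwards [hev] with t ht
  have hηM : η * ‖ζn n‖ ≤ δ / 4 := by
    calc η * ‖ζn n‖ ≤ δ / (4 * M) * M :=
          mul_le_mul (min_le_right _ _) hnM (norm_nonneg _) (by positivity)
      _ = δ / 4 := by field_simp
  rw [dist_eq_norm]
  have := norm_sub_le_norm_sub_add_norm_sub (t⁻¹ • X t x) (ζn n) ζ
  linarith [min_le_left (δ / 4) 1]
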